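/- arXiv:2604.23649 — 10 statements merged into one kernel-verified Lean document; each statement's English description precedes it below -/
import Mathlib

section
/- Let α > 1, Δ ≥ 0, a > 0, b > 0, and set A = (1−α)a + αb. For every z ∈ ℝ with z + A > 0, z + a > 0 and z + b > 0, the privacy loss function g has derivative at z equal to g′(z) = −(α/(2(z+A))) · [ Δ/(z+A) + (a−b)² / ((z+a)(z+b)) ]. -/
/-- The privacy loss function: for `α > 1`, `Δ ≥ 0`, `a > 0`, `b > 0`, with
`A = (1−α)a + αb`, `g(z) = αΔ/(2(z+A)) + (1/(2(1−α))) ln((z+A)/((z+a)^{1−α}(z+b)^α))`. -/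
noncomputable def privacyLoss (α Δ a b z : ℝ) : ℝ :=
  α * Δ / (2 * (z + ((1 - α) * a + α * b)))
    + (1 / (2 * (1 - α))) * Real.log ((z + ((1 - α) * a + α * b))
        / ((z + a) ^ (1 - α) * (z + b) ^ α))

/-- Where all three factors are positive, the logarithm in the privacy loss splits into a sum. -/
theorem privacyLoss_eq_sum_log {α Δ a b z : ℝ} (hzA : 0 < z + ((1 - α) * a + α * b))
    (hza : 0 < z + a) (hzb : 0 < z + b) :
    privacyLoss α Δ a b z = α * Δ / (2 * (z + ((1 - α) * a + α * b)))
      + (1 / (2 * (1 - α))) * (Real.log (z + ((1 - α) * a + α * b))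
        - ((1 - α) * Real.log (z + a) + α * Real.log (z + b))) := by
  have hpa := Real.rpow_pos_of_pos hza (1 - α)
  have hpb := Real.rpow_pos_of_pos hzb α
  rw [privacyLoss, Real.log_div hzA.ne' (mul_pos hpa hpb).ne', Real.log_mul hpa.ne' hpb.ne',
    Real.log_rpow hza, Real.log_rpow hzb]

theorem stmt_2 (α Δ a b : ℝ) (hα : 1 < α) (hΔ : 0 ≤ Δ) (ha : 0 < a) (hb : 0 < b)
    (z : ℝ) (hzA : 0 < z + ((1 - α) * a + α * b)) (hza : 0 < z + a) (hzb : 0 < z + b) :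
    HasDerivAt (privacyLoss α Δ a b)
      (-(α / (2 * (z + ((1 - α) * a + α * b))))
        * (Δ / (z + ((1 - α) * a + α * b)) + (a - b) ^ 2 / ((z + a) * (z + b)))) z := by
  have h_shift (c : ℝ) : HasDerivAt (fun x : ℝ => x + c) 1 z := (hasDerivAt_id z).add_const c
  have h_near {c : ℝ} (hc : 0 < z + c) : ∀ᶠ x in nhds z, 0 < x + c :=
    (h_shift c).continuousAt.eventually (lt_mem_nhds hc)
  have h_eq : privacyLoss α Δ a b =ᶠ[nhds z] fun x =>
      α * Δ / (2 * (x + ((1 - α) * a + α * b)))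
        + (1 / (2 * (1 - α))) * (Real.log (x + ((1 - α) * a + α * b))
          - ((1 - α) * Real.log (x + a) + α * Real.log (x + b))) := by
    filter_upwards [h_near hzA, h_near hza, h_near hzb] with x hxA hxa hxb
    exact privacyLoss_eq_sum_log hxA hxa hxb
  refine HasDerivAt.congr_of_eventuallyEq ?_ h_eq
  have h_frac := (hasDerivAt_const z (α * Δ)).fun_div
    ((h_shift ((1 - α) * a + α * b)).const_mul 2) (mul_pos two_pos hzA).ne'
  have h_log := (((h_shift ((1 - α) * a + α * b)).log hzA.ne').fun_sub
    ((((h_shift a).log hza.ne').const_mul (1 - α)).fun_add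
      (((h_shift b).log hzb.ne').const_mul α))).const_mul (1 / (2 * (1 - α)))
  refine (h_frac.fun_add h_log).congr_deriv ?_
  have hα' : 1 - α ≠ 0 := by linarith
  have hA := hzA.ne'
  have h_a := hza.ne'
  have h_b := hzb.ne'
  field_simp
  ring
end

section
/- Let α > 1, Δ ≥ 0, a > 0, b > 0, and set A = (1−α)a + αb. The privacy loss function g is antitone (monotonically non-increasing) on the interval { z ∈ ℝ : z > max(−A, −a, −b) }. -/
/-- For `α > 1`, the Jensen gap `log s - (1 - α) log p - α log q` with
`s = (1 - α) p + α q` is monotone along simultaneous translations of `p` and `q`. -/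
theorem monotoneOn_log_affine_sub (α a b : ℝ) (hα : 1 < α) :
    MonotoneOn (fun z : ℝ => Real.log (z + ((1 - α) * a + α * b))
        - ((1 - α) * Real.log (z + a) + α * Real.log (z + b)))
      (Set.Ioi (max (max (-((1 - α) * a + α * b)) (-a)) (-b))) := by
  have hderiv : ∀ z ∈ Set.Ioi (max (max (-((1 - α) * a + α * b)) (-a)) (-b)),
      HasDerivAt (fun z : ℝ => Real.log (z + ((1 - α) * a + α * b))
          - ((1 - α) * Real.log (z + a) + α * Real.log (z + b)))
        (α * (α - 1) * (a - b) ^ 2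
          / ((z + ((1 - α) * a + α * b)) * (z + a) * (z + b))) z ∧
      0 < (z + ((1 - α) * a + α * b)) * (z + a) * (z + b) := by
    intro z hz
    simp only [Set.mem_Ioi, max_lt_iff] at hz
    obtain ⟨⟨hA, ha⟩, hb⟩ := hz
    have hA' : 0 < z + ((1 - α) * a + α * b) := by linarith
    have ha' : 0 < z + a := by linarith
    have hb' : 0 < z + b := by linarith
    refine ⟨?_, by positivity⟩
    have hlog : ∀ c : ℝ, 0 < z + c → HasDerivAt (fun x => Real.log (x + c)) (1 / (z + c)) z :=
      fun c hc => ((hasDerivAt_id z).add_const c).log hc.ne'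
    refine ((hlog _ hA').sub (((hlog _ ha').const_mul (1 - α)).add
      ((hlog _ hb').const_mul α))).congr_deriv ?_
    have hA'' := hA'.ne'
    field_simp
    ring
  refine monotoneOn_of_deriv_nonneg (convex_Ioi _)
    (fun z hz => (hderiv z hz).1.continuousAt.continuousWithinAt) ?_ ?_ <;>
    rw [interior_Ioi] <;> intro z hz
  · exact (hderiv z hz).1.differentiableAt.differentiableWithinAt
  · rw [(hderiv z hz).1.deriv]
    have hα' : 0 ≤ α - 1 := by linarith
    have hpos := (hderiv z hz).2
    positivity

/-- On its domain the privacy loss is a rational term plus a multiple of a Jensen gap. -/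
theorem privacyLoss_eq_log_sub (α Δ a b z : ℝ)
    (hA : 0 < z + ((1 - α) * a + α * b)) (ha : 0 < z + a) (hb : 0 < z + b) :
    privacyLoss α Δ a b z = α * Δ / (2 * (z + ((1 - α) * a + α * b)))
      + (1 / (2 * (1 - α))) * (Real.log (z + ((1 - α) * a + α * b))
        - ((1 - α) * Real.log (z + a) + α * Real.log (z + b))) := by
  rw [privacyLoss, Real.log_div hA.ne' (by positivity),
    Real.log_mul (by positivity) (by positivity), Real.log_rpow ha, Real.log_rpow hb]

theorem stmt_3 (α Δ a b : ℝ) (hα : 1 < α) (hΔ : 0 ≤ Δ) (ha : 0 < a) (hb : 0 < b) :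
    AntitoneOn (privacyLoss α Δ a b)
      {z : ℝ | max (max (-((1 - α) * a + α * b)) (-a)) (-b) < z} := by
  intro x hx y hy hxy
  have hmono := monotoneOn_log_affine_sub α a b hα hx hy hxy
  simp only [Set.mem_ofPred_eq, max_lt_iff] at hx hy
  obtain ⟨⟨hxA, hxa⟩, hxb⟩ := hx
  obtain ⟨⟨hyA, hya⟩, hyb⟩ := hy
  rw [privacyLoss_eq_log_sub α Δ a b x (by linarith) (by linarith) (by linarith),
    privacyLoss_eq_log_sub α Δ a b y (by linarith) (by linarith) (by linarith)]
  refine add_le_add ?_ (mul_le_mul_of_nonpos_left hmono ?_)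
  · have hA : 0 < x + ((1 - α) * a + α * b) := by linarith
    have hα' : 0 ≤ α := by linarith
    gcongr
  · exact div_nonpos_of_nonneg_of_nonpos zero_le_one (by linarith)
end

section
/- Let α > 1, Δ ≥ 0, a > 0, b > 0, and set A = (1−α)a + αb. If Δ > 0 or a ≠ b, then the privacy loss function g is strictly antitone (strictly decreasing) on the interval { z ∈ ℝ : z > max(−A, −a, −b) }. -/
theorem privacyLoss_eq_of_pos {α Δ a b z : ℝ} (hA : 0 < z + ((1 - α) * a + α * b))
    (ha : 0 < z + a) (hb : 0 < z + b) :
    privacyLoss α Δ a b z = α * Δ / 2 * (z + ((1 - α) * a + α * b))⁻¹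
      + 1 / (2 * (1 - α)) * (Real.log (z + ((1 - α) * a + α * b))
        - ((1 - α) * Real.log (z + a) + α * Real.log (z + b))) := by
  have hu := Real.rpow_pos_of_pos ha (1 - α)
  have hv := Real.rpow_pos_of_pos hb α
  rw [privacyLoss, Real.log_div hA.ne' (mul_pos hu hv).ne', Real.log_mul hu.ne' hv.ne',
    Real.log_rpow ha, Real.log_rpow hb, ← div_div, div_eq_mul_inv (α * Δ / 2)]

theorem hasDerivAt_privacyLoss {α Δ a b z : ℝ} (hα : α ≠ 1)
    (hA : 0 < z + ((1 - α) * a + α * b)) (ha : 0 < z + a) (hb : 0 < z + b) :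
    HasDerivAt (privacyLoss α Δ a b)
      (-(α * (Δ / (2 * (z + ((1 - α) * a + α * b)) ^ 2)
        + (a - b) ^ 2 / (2 * ((z + ((1 - α) * a + α * b)) * (z + a) * (z + b)))))) z := by
  have eventually_pos : ∀ c : ℝ, 0 < z + c → ∀ᶠ y in nhds z, 0 < y + c := fun c hc =>
    (continuous_id.add continuous_const).continuousAt.eventually_const_lt hc
  have hshift : ∀ c : ℝ, HasDerivAt (fun y : ℝ => y + c) 1 z := fun c =>
    (hasDerivAt_id z).add_const c
  have h := (((hshift ((1 - α) * a + α * b)).fun_inv hA.ne').const_mul (α * Δ / 2)).add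
    ((((hshift ((1 - α) * a + α * b)).log hA.ne').sub
      ((((hshift a).log ha.ne').const_mul (1 - α)).add
        (((hshift b).log hb.ne').const_mul α))).const_mul (1 / (2 * (1 - α))))
  refine (h.congr_of_eventuallyEq ?_).congr_deriv ?_
  · filter_upwards [eventually_pos _ hA, eventually_pos _ ha, eventually_pos _ hb]
      with y hyA hya hyb
    exact privacyLoss_eq_of_pos hyA hya hyb
  · have h1 : 1 - α ≠ 0 := sub_ne_zero.mpr hα.symm
    have hA' := hA.ne'
    have ha' := ha.ne'
    have hb' := hb.ne'
    field_simp
    ring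

theorem stmt_4 (α Δ a b : ℝ) (hα : 1 < α) (hΔ : 0 ≤ Δ) (ha : 0 < a) (hb : 0 < b)
    (hnd : 0 < Δ ∨ a ≠ b) :
    StrictAntiOn (privacyLoss α Δ a b)
      {z : ℝ | max (max (-((1 - α) * a + α * b)) (-a)) (-b) < z} := by
  have hpos : ∀ z ∈ Set.Ioi (max (max (-((1 - α) * a + α * b)) (-a)) (-b)),
      0 < z + ((1 - α) * a + α * b) ∧ 0 < z + a ∧ 0 < z + b := by
    intro z hz
    simp only [Set.mem_Ioi, max_lt_iff] at hz
    obtain ⟨⟨h1, h2⟩, h3⟩ := hz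
    exact ⟨by linarith, by linarith, by linarith⟩
  change StrictAntiOn _ (Set.Ioi _)
  refine strictAntiOn_of_deriv_neg (convex_Ioi _) (fun z hz => ?_) (fun z hz => ?_)
  · obtain ⟨hA, hu, hv⟩ := hpos z hz
    exact (hasDerivAt_privacyLoss hα.ne' hA hu hv).continuousAt.continuousWithinAt
  · rw [interior_Ioi] at hz
    obtain ⟨hA, hu, hv⟩ := hpos z hz
    rw [(hasDerivAt_privacyLoss hα.ne' hA hu hv).deriv, neg_lt_zero]
    refine mul_pos (by linarith) ?_
    rcases hnd with h | h
    · exact add_pos_of_pos_of_nonneg (by positivity) (by positivity)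
    · have := sub_ne_zero.mpr h
      exact add_pos_of_nonneg_of_pos (by positivity) (by positivity)
end

section
/- (Closed-form mechanism.) Let ε > 0, α > 1, μᵢ, μⱼ ∈ ℝ and σᵢ², σⱼ² > 0. Write Δ = (μᵢ−μⱼ)², δ = σⱼ² − σᵢ², and E = Δ − 2εδ. If θ² ≥ (α/(4ε)) · ( E + √( E² + 8εδ²/(α−1) ) ) − σᵢ², then θ² + (1−α)σᵢ² + ασⱼ² > 0 and the Rényi divergence of order α between the Gaussian densities φ(·; μᵢ, σᵢ²+θ²) and φ(·; μⱼ, σⱼ²+θ²) is at most ε. -/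
open MeasureTheory

/-- The density of the Gaussian distribution `N(μ, v)` with mean `μ` and variance `v`. -/
noncomputable def gaussianPdf (μ v y : ℝ) : ℝ :=
  (2 * Real.pi * v) ^ (-(1 : ℝ) / 2) * Real.exp (-(y - μ) ^ 2 / (2 * v))

/-- The Rényi divergence of order `α` between two densities `p` and `q` on `ℝ`. -/
noncomputable def renyiDiv (α : ℝ) (p q : ℝ → ℝ) : ℝ :=
  (1 / (α - 1)) * Real.log (∫ y : ℝ, (p y) ^ α * (q y) ^ (1 - α))

/-- The Hellinger-type integral of order `α` between two Gaussian densities, in closed form. -/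
theorem integral_gaussianPdf_rpow_mul_rpow {α μ ν a b : ℝ} (ha : 0 < a) (hb : 0 < b)
    (hS : 0 < (1 - α) * a + α * b) :
    ∫ y : ℝ, gaussianPdf μ a y ^ α * gaussianPdf ν b y ^ (1 - α) =
      (2 * Real.pi * a) ^ (-(1 : ℝ) / 2 * α) * (2 * Real.pi * b) ^ (-(1 : ℝ) / 2 * (1 - α)) *
        Real.exp (α * (α - 1) * (μ - ν) ^ 2 / (2 * ((1 - α) * a + α * b))) *
        Real.sqrt (Real.pi / (((1 - α) * a + α * b) / (2 * a * b))) := by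
  set S := (1 - α) * a + α * b with hSdef
  have hpoint (y : ℝ) : gaussianPdf μ a y ^ α * gaussianPdf ν b y ^ (1 - α) =
      (2 * Real.pi * a) ^ (-(1 : ℝ) / 2 * α) * (2 * Real.pi * b) ^ (-(1 : ℝ) / 2 * (1 - α)) *
        Real.exp (α * (α - 1) * (μ - ν) ^ 2 / (2 * S)) *
        Real.exp (-(S / (2 * a * b)) *
          (y - (α * b * μ + (1 - α) * a * ν) / S) ^ 2) := by
    have hexp : -(y - μ) ^ 2 / (2 * a) * α + -(y - ν) ^ 2 / (2 * b) * (1 - α) =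
        α * (α - 1) * (μ - ν) ^ 2 / (2 * S) +
          -(S / (2 * a * b)) * (y - (α * b * μ + (1 - α) * a * ν) / S) ^ 2 := by
      have hS' := hS.ne'
      field_simp
      rw [hSdef]
      ring
    unfold gaussianPdf
    rw [Real.mul_rpow (by positivity) (Real.exp_pos _).le,
      Real.mul_rpow (by positivity) (Real.exp_pos _).le,
      ← Real.rpow_mul (by positivity), ← Real.rpow_mul (by positivity),
      ← Real.exp_mul, ← Real.exp_mul, mul_mul_mul_comm, ← Real.exp_add, hexp, Real.exp_add,
      ← mul_assoc]
  simp_rw [hpoint]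
  rw [integral_const_mul,
    integral_sub_right_eq_self (fun y : ℝ => Real.exp (-(S / (2 * a * b)) * y ^ 2)),
    integral_gaussian]

/-- The Rényi divergence between two Gaussian densities, in closed form. -/
theorem renyiDiv_gaussianPdf {α μ ν a b : ℝ} (hα : 1 < α) (ha : 0 < a) (hb : 0 < b)
    (hS : 0 < (1 - α) * a + α * b) :
    renyiDiv α (gaussianPdf μ a) (gaussianPdf ν b) =
      α * (μ - ν) ^ 2 / (2 * ((1 - α) * a + α * b)) +
        ((1 - α) * Real.log a + α * Real.log b - Real.log ((1 - α) * a + α * b)) /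
          (2 * (α - 1)) := by
  have hα' : α - 1 ≠ 0 := by linarith
  rw [renyiDiv, integral_gaussianPdf_rpow_mul_rpow ha hb hS]
  set S := (1 - α) * a + α * b
  rw [Real.log_mul (by positivity) (by positivity), Real.log_mul (by positivity) (by positivity),
    Real.log_mul (by positivity) (by positivity), Real.log_rpow (by positivity),
    Real.log_rpow (by positivity), Real.log_exp, Real.log_sqrt (by positivity),
    Real.log_div Real.pi_ne_zero (by positivity), Real.log_div hS.ne' (by positivity),
    Real.log_mul (by positivity) hb.ne', Real.log_mul (by positivity) ha.ne',
    Real.log_mul (by positivity) hb.ne', Real.log_mul two_ne_zero ha.ne',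
    Real.log_mul two_ne_zero Real.pi_ne_zero]
  field_simp
  ring

/-- A bound on the Rényi divergence between two Gaussian densities without logarithms. -/
theorem renyiDiv_gaussianPdf_le {α μ ν a b : ℝ} (hα : 1 < α) (ha : 0 < a) (hb : 0 < b)
    (hS : 0 < (1 - α) * a + α * b) :
    renyiDiv α (gaussianPdf μ a) (gaussianPdf ν b) ≤
      α * (μ - ν) ^ 2 / (2 * ((1 - α) * a + α * b)) +
        α ^ 2 * (b - a) ^ 2 / (a * ((1 - α) * a + α * b)) / (2 * (α - 1)) := by
  rw [renyiDiv_gaussianPdf hα ha hb hS]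
  set S := (1 - α) * a + α * b with hSdef
  have hba := Real.log_le_sub_one_of_pos (div_pos hb ha)
  have haS := Real.log_le_sub_one_of_pos (div_pos ha hS)
  rw [Real.log_div hb.ne' ha.ne'] at hba
  rw [Real.log_div ha.ne' hS.ne'] at haS
  have hα' : 0 < α - 1 := by linarith
  have hsum : α * (b / a - 1) + (a / S - 1) = α ^ 2 * (b - a) ^ 2 / (a * S) := by
    have hS' := hS.ne'
    field_simp
    rw [hSdef]
    ring
  gcongr
  nlinarith [mul_le_mul_of_nonneg_left hba (by linarith : (0 : ℝ) ≤ α)]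

theorem stmt_8 (ε α μi μj si2 sj2 θ2 : ℝ) (hε : 0 < ε) (hα : 1 < α)
    (hsi : 0 < si2) (hsj : 0 < sj2) (hθ2 : 0 ≤ θ2)
    (hθ : (α / (4 * ε)) * (((μi - μj) ^ 2 - 2 * ε * (sj2 - si2))
        + Real.sqrt (((μi - μj) ^ 2 - 2 * ε * (sj2 - si2)) ^ 2
            + 8 * ε * (sj2 - si2) ^ 2 / (α - 1))) - si2 ≤ θ2) :
    0 < θ2 + (1 - α) * si2 + α * sj2
    ∧ renyiDiv α (gaussianPdf μi (si2 + θ2)) (gaussianPdf μj (sj2 + θ2)) ≤ ε := by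
  have hα' : 0 < α - 1 := by linarith
  have hα0 : 0 < α := by linarith
  set δ := sj2 - si2 with hδ
  set E := (μi - μj) ^ 2 - 2 * ε * δ with hE
  obtain ⟨a, ha_def⟩ : ∃ a, a = si2 + θ2 := ⟨_, rfl⟩
  have ha : 0 < a := by linarith
  have hb : 0 < sj2 + θ2 := by linarith
  have hsqrt : Real.sqrt (E ^ 2 + 8 * ε * δ ^ 2 / (α - 1)) ≤ 4 * ε * a / α - E := by
    have h : α / (4 * ε) * (E + Real.sqrt (E ^ 2 + 8 * ε * δ ^ 2 / (α - 1))) ≤ a := by linarith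
    rw [div_mul_eq_mul_div, div_le_iff₀ (by positivity)] at h
    rw [le_sub_iff_add_le, le_div_iff₀ hα0]
    linarith
  have hsq := (Real.sqrt_le_iff.mp hsqrt).2
  have hquad : α * a * (μi - μj) ^ 2 + α ^ 2 * δ ^ 2 / (α - 1) ≤ 2 * ε * a * (a + α * δ) := by
    have h : 0 ≤ α ^ 2 / (8 * ε) *
        ((4 * ε * a / α - E) ^ 2 - (E ^ 2 + 8 * ε * δ ^ 2 / (α - 1))) :=
      mul_nonneg (by positivity) (by linarith)
    have heq : α ^ 2 / (8 * ε) *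
        ((4 * ε * a / α - E) ^ 2 - (E ^ 2 + 8 * ε * δ ^ 2 / (α - 1))) =
        2 * ε * a * (a + α * δ) - (α * a * (μi - μj) ^ 2 + α ^ 2 * δ ^ 2 / (α - 1)) := by
      rw [hE]
      field_simp
      ring
    linarith
  have hpos : 0 < a + α * δ := by
    rcases eq_or_ne δ 0 with h | h
    · simpa [h] using ha
    · have : 0 < 2 * ε * a * (a + α * δ) := lt_of_lt_of_le (by positivity) hquad
      exact pos_of_mul_pos_right this (by positivity)
  have hS : (1 - α) * a + α * (sj2 + θ2) = a + α * δ := by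
    rw [hδ, ha_def]
    ring
  refine ⟨by rw [hδ, ha_def] at hpos; linarith, ?_⟩
  rw [← ha_def]
  refine (renyiDiv_gaussianPdf_le hα ha hb (hS ▸ hpos)).trans ?_
  rw [hS, show sj2 + θ2 - a = δ by rw [hδ, ha_def]; ring]
  have hbound : α * (μi - μj) ^ 2 / (2 * (a + α * δ)) +
      α ^ 2 * δ ^ 2 / (a * (a + α * δ)) / (2 * (α - 1)) =
      (α * a * (μi - μj) ^ 2 + α ^ 2 * δ ^ 2 / (α - 1)) / (2 * a * (a + α * δ)) := by
    have hpos' := hpos.ne'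
    field_simp
  rw [hbound, div_le_iff₀ (by positivity)]
  linarith
end

section
/- Let α > 1 and let η_i > 0, η_j > 0 satisfy η_i + α(η_j − η_i) > 0. Then (1/(2(α−1))) · ( α·ln(η_j/η_i) − ln( (η_i + α(η_j − η_i)) / η_i ) ) ≤ α²(η_j − η_i)² / ( 2(α−1)·η_i·(η_i + α(η_j − η_i)) ). -/
theorem stmt_10 (α ηi ηj : ℝ) (hα : 1 < α) (hi : 0 < ηi) (hj : 0 < ηj)
    (hpos : 0 < ηi + α * (ηj - ηi)) :
    (1 / (2 * (α - 1))) * (α * Real.log (ηj / ηi)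
        - Real.log ((ηi + α * (ηj - ηi)) / ηi))
      ≤ α ^ 2 * (ηj - ηi) ^ 2 / (2 * (α - 1) * ηi * (ηi + α * (ηj - ηi))) := by
  have hα' : 0 < α - 1 := sub_pos.mpr hα
  have hlog_ratio : α * Real.log (ηj / ηi) ≤ α * (ηj / ηi - 1) :=
    mul_le_mul_of_nonneg_left (Real.log_le_sub_one_of_pos (div_pos hj hi)) (by linarith)
  have hlog_mix := Real.one_sub_inv_le_log_of_pos (div_pos hpos hi)
  calc
    _ ≤ (1 / (2 * (α - 1))) * (α * (ηj / ηi - 1)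
          - (1 - ((ηi + α * (ηj - ηi)) / ηi)⁻¹)) := by gcongr
    _ = _ := by
      have hne := hpos.ne'
      field_simp
      ring
end

section
/- Let α > 1, Δ ≥ 0 and δ ≠ 0. Define D(ε) = √( (Δ − 2εδ)² + 8εδ²/(α−1) ) − (Δ − 2εδ) for ε > 0. Then D is strictly increasing on (0, ∞). -/
/-- If `t` is the positive root of `t ^ 2 + 2 * (Δ - 2 * ε * δ) * t = c * ε`, then `t` is strictly
increasing in `ε`. -/
theorem lt_of_quadratic_root {c Δ δ x y t s : ℝ} (hc : 0 < c) (hΔ : 0 ≤ Δ) (hx : 0 < x)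
    (hxy : x < y) (ht : 0 < t) (hs : 0 < s) (hxt : t ^ 2 + 2 * (Δ - 2 * x * δ) * t = c * x)
    (hys : s ^ 2 + 2 * (Δ - 2 * y * δ) * s = c * y) : t < s := by
  have hxt' : x * (c + 4 * δ * t) = t ^ 2 + 2 * Δ * t := by linarith
  have hys' : y * (c + 4 * δ * s) = s ^ 2 + 2 * Δ * s := by linarith
  have hT : 0 < c + 4 * δ * t :=
    pos_of_mul_pos_right (hxt' ▸ by positivity : 0 < x * (c + 4 * δ * t)) hx.le
  have hS : 0 < c + 4 * δ * s :=
    pos_of_mul_pos_right (hys' ▸ by positivity : 0 < y * (c + 4 * δ * s)) (hx.trans hxy).le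
  by_contra! hst
  have hlt : x * (c + 4 * δ * t) * (c + 4 * δ * s) < y * (c + 4 * δ * s) * (c + 4 * δ * t) := by
    have := mul_lt_mul_of_pos_right hxy (mul_pos hT hS)
    linarith
  rw [hxt', hys'] at hlt
  have hfac : 0 ≤ (t - s) * (c * (t + 2 * Δ) + s * (c + 4 * δ * t)) :=
    mul_nonneg (sub_nonneg.2 hst) (by positivity)
  linarith

theorem stmt_13 (α Δ δ : ℝ) (hα : 1 < α) (hΔ : 0 ≤ Δ) (hδ : δ ≠ 0) :
    StrictMonoOn (fun ε : ℝ =>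
        Real.sqrt ((Δ - 2 * ε * δ) ^ 2 + 8 * ε * δ ^ 2 / (α - 1)) - (Δ - 2 * ε * δ))
      (Set.Ioi (0 : ℝ)) := by
  have hα' : 0 < α - 1 := sub_pos.2 hα
  have hc : 0 < 8 * δ ^ 2 / (α - 1) := by positivity
  have hpos (ε : ℝ) (hε : 0 < ε) :
      0 < √((Δ - 2 * ε * δ) ^ 2 + 8 * ε * δ ^ 2 / (α - 1)) - (Δ - 2 * ε * δ) := by
    have h : 0 < 8 * ε * δ ^ 2 / (α - 1) := by positivity
    exact sub_pos.2 (Real.lt_sqrt_of_sq_lt (by linarith))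
  have hroot (ε : ℝ) (hε : 0 < ε) :
      (√((Δ - 2 * ε * δ) ^ 2 + 8 * ε * δ ^ 2 / (α - 1)) - (Δ - 2 * ε * δ)) ^ 2
        + 2 * (Δ - 2 * ε * δ) *
          (√((Δ - 2 * ε * δ) ^ 2 + 8 * ε * δ ^ 2 / (α - 1)) - (Δ - 2 * ε * δ))
        = 8 * δ ^ 2 / (α - 1) * ε := by
    have h : 0 ≤ (Δ - 2 * ε * δ) ^ 2 + 8 * ε * δ ^ 2 / (α - 1) := by positivity
    linear_combination Real.sq_sqrt h
  intro x hx y hy hxy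
  exact lt_of_quadratic_root hc hΔ hx hxy (hpos x hx) (hpos y hy) (hroot x hx) (hroot y hy)
end

section
/- Let α > 1, Δ ≥ 0 and δ ∈ ℝ. Define h(ε) = (α/(4ε)) · ( (Δ − 2εδ) + √( (Δ − 2εδ)² + 8εδ²/(α−1) ) ) for ε > 0. Then h is antitone (monotonically non-increasing) on (0, ∞); moreover, if δ ≠ 0 or Δ > 0, then h is strictly decreasing on (0, ∞). -/
theorem add_sqrt_sq_add_lt {p q k l : ℝ} (hpq : p ≤ q) (hk : 0 ≤ k) (hkl : k ≤ l)
    (h : k < l ∨ (p < q ∧ 0 < q)) :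
    p + Real.sqrt (p ^ 2 + k) < q + Real.sqrt (q ^ 2 + l) := by
  have hl : 0 < q ^ 2 + l := by
    rcases h with h | ⟨-, h⟩
    · nlinarith [sq_nonneg q]
    · nlinarith [pow_pos h 2]
  have hr2 : Real.sqrt (q ^ 2 + l) ^ 2 = q ^ 2 + l := Real.sq_sqrt hl.le
  have hr0 : 0 < Real.sqrt (q ^ 2 + l) := Real.sqrt_pos.2 hl
  have hrq : -q ≤ Real.sqrt (q ^ 2 + l) := Real.le_sqrt_of_sq_le (by nlinarith)
  set r := Real.sqrt (q ^ 2 + l)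
  have hlt : Real.sqrt (p ^ 2 + k) < q - p + r := by
    rw [Real.sqrt_lt' (by linarith)]
    rcases h with h | ⟨h, hq⟩
    · nlinarith [mul_nonneg (sub_nonneg.2 hpq) (neg_le_iff_add_nonneg.1 hrq)]
    · nlinarith [mul_pos (sub_pos.2 h) (add_pos hr0 hq)]
  linarith

theorem div_mul_add_sqrt_eq (α Δ δ : ℝ) {ε : ℝ} (hε : 0 < ε) :
    (α / (4 * ε)) * ((Δ - 2 * ε * δ)
        + Real.sqrt ((Δ - 2 * ε * δ) ^ 2 + 8 * ε * δ ^ 2 / (α - 1)))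
      = α / 4 * ((Δ / ε - 2 * δ)
        + Real.sqrt ((Δ / ε - 2 * δ) ^ 2 + 8 * δ ^ 2 / (α - 1) / ε)) := by
  have h : (Δ - 2 * ε * δ) ^ 2 + 8 * ε * δ ^ 2 / (α - 1)
      = ε ^ 2 * ((Δ / ε - 2 * δ) ^ 2 + 8 * δ ^ 2 / (α - 1) / ε) := by
    field_simp
  rw [h, Real.sqrt_mul (sq_nonneg ε), Real.sqrt_sq hε.le]
  field_simp

theorem strictAntiOn_div_mul_add_sqrt (α Δ δ : ℝ) (hα : 1 < α) (hΔ : 0 ≤ Δ)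
    (h : δ ≠ 0 ∨ 0 < Δ) :
    StrictAntiOn (fun ε : ℝ => (α / (4 * ε)) * ((Δ - 2 * ε * δ)
        + Real.sqrt ((Δ - 2 * ε * δ) ^ 2 + 8 * ε * δ ^ 2 / (α - 1))))
      (Set.Ioi (0 : ℝ)) := by
  intro a ha b hb hab
  rw [Set.mem_Ioi] at ha hb
  have hα' : 0 < α - 1 := sub_pos.2 hα
  have hc : 0 ≤ 8 * δ ^ 2 / (α - 1) := by positivity
  simp only [div_mul_add_sqrt_eq α Δ δ ha, div_mul_add_sqrt_eq α Δ δ hb]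
  refine mul_lt_mul_of_pos_left (add_sqrt_sq_add_lt ?_ (div_nonneg hc hb.le) ?_ ?_) (by linarith)
  · exact sub_le_sub_right (div_le_div_of_nonneg_left hΔ ha hab.le) _
  · exact div_le_div_of_nonneg_left hc ha hab.le
  · by_cases hδ : δ = 0
    · subst hδ
      have hΔ' : 0 < Δ := h.resolve_left (by simp)
      refine Or.inr ⟨sub_lt_sub_right (div_lt_div_of_pos_left hΔ' ha hab) _, ?_⟩
      simpa using div_pos hΔ' ha
    · exact Or.inl (div_lt_div_of_pos_left (by positivity) ha hab)

theorem stmt_14 (α Δ δ : ℝ) (hα : 1 < α) (hΔ : 0 ≤ Δ) :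
    AntitoneOn (fun ε : ℝ => (α / (4 * ε)) * ((Δ - 2 * ε * δ)
        + Real.sqrt ((Δ - 2 * ε * δ) ^ 2 + 8 * ε * δ ^ 2 / (α - 1))))
      (Set.Ioi (0 : ℝ))
    ∧ ((δ ≠ 0 ∨ 0 < Δ) →
      StrictAntiOn (fun ε : ℝ => (α / (4 * ε)) * ((Δ - 2 * ε * δ)
          + Real.sqrt ((Δ - 2 * ε * δ) ^ 2 + 8 * ε * δ ^ 2 / (α - 1))))
        (Set.Ioi (0 : ℝ))) := by
  refine ⟨?_, strictAntiOn_div_mul_add_sqrt α Δ δ hα hΔ⟩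
  by_cases h : δ ≠ 0 ∨ 0 < Δ
  · exact (strictAntiOn_div_mul_add_sqrt α Δ δ hα hΔ h).antitoneOn
  · push Not at h
    obtain ⟨rfl, hΔ'⟩ := h
    obtain rfl : Δ = 0 := le_antisymm hΔ' hΔ
    intro a _ b _ _
    simp
end

section
/- Let ε > 0, Δ ≥ 0 and δ ∈ ℝ, and set E = Δ − 2εδ. Define H(α) = (α/(4ε)) · ( E + √( E² + 8εδ²/(α−1) ) ) for α > 1. If at some α > 1 one has Δ > 2εδ + ((2−α)/(α−1))·√(2ε)·|δ|, then the derivative of H at α is strictly positive. -/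
/-- If `E` exceeds `(1 - t) / t * c`, then the larger root `E + √(E² + 4c²/t)` of
`x² - 2Ex - 4c²/t` exceeds `2c / t`. -/
theorem two_mul_div_lt_add_sqrt {E c t : ℝ} (hc : 0 ≤ c) (ht : 0 < t)
    (h : (1 - t) / t * c < E) :
    2 * c / t < E + Real.sqrt (E ^ 2 + 4 * c ^ 2 / t) := by
  rcases hc.eq_or_lt with rfl | hc
  · have hE : 0 < E := by simpa using h
    have := Real.sqrt_nonneg (E ^ 2 + 4 * (0 : ℝ) ^ 2 / t)
    simp only [mul_zero, zero_div]
    linarith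
  · rw [← sub_lt_iff_lt_add']
    apply Real.lt_sqrt_of_sq_lt
    have hpos : 0 < 4 * c / t * (E - (1 - t) / t * c) :=
      mul_pos (by positivity) (sub_pos.2 h)
    have key : E ^ 2 + 4 * c ^ 2 / t - (2 * c / t - E) ^ 2
        = 4 * c / t * (E - (1 - t) / t * c) := by
      field_simp
      ring
    linarith

theorem stmt_15 (ε Δ δ α : ℝ) (hε : 0 < ε) (hΔ : 0 ≤ Δ) (hα : 1 < α)
    (hcond : 2 * ε * δ + ((2 - α) / (α - 1)) * Real.sqrt (2 * ε) * |δ| < Δ) :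
    ∃ d : ℝ, HasDerivAt (fun a : ℝ => (a / (4 * ε)) * ((Δ - 2 * ε * δ)
        + Real.sqrt ((Δ - 2 * ε * δ) ^ 2 + 8 * ε * δ ^ 2 / (a - 1)))) d α ∧ 0 < d := by
  have ht : 0 < α - 1 := sub_pos.2 hα
  set E := Δ - 2 * ε * δ with hE
  set c := Real.sqrt (2 * ε) * |δ| with hc
  have hc0 : 0 ≤ c := by positivity
  have hc2 : c ^ 2 = 2 * ε * δ ^ 2 := by
    rw [hc, mul_pow, Real.sq_sqrt (by positivity), sq_abs]
  have hEc : (1 - (α - 1)) / (α - 1) * c < E := by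
    have : (1 - (α - 1)) / (α - 1) * c = (2 - α) / (α - 1) * Real.sqrt (2 * ε) * |δ| := by
      rw [hc]; ring
    linarith
  have h8 : 8 * ε * δ ^ 2 = 4 * c ^ 2 := by rw [hc2]; ring
  rw [h8]
  have hP := two_mul_div_lt_add_sqrt hc0 ht hEc
  have hrad : 0 < E ^ 2 + 4 * c ^ 2 / (α - 1) := by
    rcases hc0.eq_or_lt with h0 | h0
    · rw [← h0, mul_zero] at hEc
      positivity
    · positivity
  set S := Real.sqrt (E ^ 2 + 4 * c ^ 2 / (α - 1)) with hS
  have hS0 : 0 < S := Real.sqrt_pos.2 hrad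
  have hS2 : S ^ 2 = E ^ 2 + 4 * c ^ 2 / (α - 1) := Real.sq_sqrt hrad.le
  have hsub : HasDerivAt (fun a : ℝ => a - 1) 1 α := (hasDerivAt_id α).sub_const 1
  have hquot := ((hasDerivAt_const α (4 * c ^ 2)).div hsub ht.ne').const_add (E ^ 2)
  have hderiv := ((hasDerivAt_id α).div_const (4 * ε)).mul ((hquot.sqrt hrad.ne').const_add E)
  refine ⟨_, hderiv, ?_⟩
  have hsq : (2 * c / (α - 1)) ^ 2 < (E + S) ^ 2 := pow_lt_pow_left₀ hP (by positivity) two_ne_zero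
  have hPS : (E + S) * S = ((E + S) ^ 2 + 4 * c ^ 2 / (α - 1)) / 2 := by linarith
  have hgap : 0 < (E + S) * S - 2 * α * c ^ 2 / (α - 1) ^ 2 := by
    have : 2 * α * c ^ 2 / (α - 1) ^ 2
        = ((2 * c / (α - 1)) ^ 2 + 4 * c ^ 2 / (α - 1)) / 2 := by
      field_simp
      ring
    linarith
  have hd : 0 < ((E + S) * S - 2 * α * c ^ 2 / (α - 1) ^ 2) / (4 * ε * S) := by positivity
  convert hd using 1
  simp only [id, Pi.div_apply, ← hS]
  field_simp
  ring
end

section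
/- Let ε > 0, Δ ≥ 0 and δ ∈ ℝ, and set E = Δ − 2εδ. Define H(α) = (α/(4ε)) · ( E + √( E² + 8εδ²/(α−1) ) ) for α > 1. If at some α > 1 one has Δ < 2εδ + ((2−α)/(α−1))·√(2ε)·|δ|, then the derivative of H at α is strictly negative. -/
theorem stmt_16 (ε Δ δ α : ℝ) (hε : 0 < ε) (hΔ : 0 ≤ Δ) (hα : 1 < α)
    (hcond : Δ < 2 * ε * δ + ((2 - α) / (α - 1)) * Real.sqrt (2 * ε) * |δ|) :
    ∃ d : ℝ, HasDerivAt (fun a : ℝ => (a / (4 * ε)) * ((Δ - 2 * ε * δ)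
        + Real.sqrt ((Δ - 2 * ε * δ) ^ 2 + 8 * ε * δ ^ 2 / (a - 1)))) d α ∧ d < 0 := by
  have hδ : δ ≠ 0 := by
    rintro rfl
    simp at hcond
    linarith
  have ht : 0 < α - 1 := by linarith
  have hs : 0 < √(2 * ε) * |δ| := by positivity
  have hs2 : (√(2 * ε) * |δ|) ^ 2 = 2 * ε * δ ^ 2 := by
    rw [mul_pow, Real.sq_sqrt (by positivity), sq_abs]
  rw [mul_assoc ((2 - α) / (α - 1))] at hcond
  generalize √(2 * ε) * |δ| = s at *
  have hK : 8 * ε * δ ^ 2 = 4 * s ^ 2 := by rw [hs2]; ring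
  rw [hK]
  have hE : Δ - 2 * ε * δ < (2 - α) / (α - 1) * s := by linarith
  generalize Δ - 2 * ε * δ = E at *
  have hR : 0 < E ^ 2 + 4 * s ^ 2 / (α - 1) := by positivity
  have hd : HasDerivAt (fun a : ℝ => a / (4 * ε) * (E + √(E ^ 2 + 4 * s ^ 2 / (a - 1))))
      (1 / (4 * ε) * (E + √(E ^ 2 + 4 * s ^ 2 / (α - 1)))
        + α / (4 * ε) * (4 * s ^ 2 * (-1 / (α - 1) ^ 2)
          / (2 * √(E ^ 2 + 4 * s ^ 2 / (α - 1))))) α := by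
    simp only [div_eq_mul_inv (4 * s ^ 2)] at hR ⊢
    exact ((hasDerivAt_id α).div_const (4 * ε)).mul
      (((((((hasDerivAt_id α).sub_const 1).inv ht.ne').const_mul (4 * s ^ 2)).const_add
        (E ^ 2)).sqrt hR.ne').const_add E)
  refine ⟨_, hd, ?_⟩
  have hS : 0 < √(E ^ 2 + 4 * s ^ 2 / (α - 1)) := Real.sqrt_pos.2 hR
  have hS2 : √(E ^ 2 + 4 * s ^ 2 / (α - 1)) ^ 2 = E ^ 2 + 4 * s ^ 2 / (α - 1) :=
    Real.sq_sqrt hR.le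
  have hquot : (2 - α) / (α - 1) * s = s / (α - 1) - s := by field_simp; ring
  have hu : 0 < s / (α - 1) := by positivity
  have hsum : √(E ^ 2 + 4 * s ^ 2 / (α - 1)) < 2 * (s / (α - 1)) - E := by
    rw [Real.sqrt_lt' (by linarith)]
    have h : 4 * s ^ 2 / (α - 1) = 4 * s * (s / (α - 1)) := by ring
    rw [h]
    nlinarith
  have hpos : 0 < E + √(E ^ 2 + 4 * s ^ 2 / (α - 1)) := by
    have h : 0 < 4 * s ^ 2 / (α - 1) := by positivity
    have := (neg_le_abs E).trans_lt
      (Real.lt_sqrt_of_sq_lt (y := E ^ 2 + 4 * s ^ 2 / (α - 1)) (by rw [sq_abs]; linarith))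
    linarith
  generalize √(E ^ 2 + 4 * s ^ 2 / (α - 1)) = S at *
  have hmul : (E + S) * S < 2 * α * s ^ 2 / (α - 1) ^ 2 := by
    have h : 2 * α * s ^ 2 / (α - 1) ^ 2
        = ((2 * (s / (α - 1))) ^ 2 + 4 * s ^ 2 / (α - 1)) / 2 := by
      field_simp
      ring
    rw [h]
    nlinarith
  rw [← lt_div_iff₀ hS] at hmul
  have hfinal : 1 / (4 * ε) * (E + S - 2 * α * s ^ 2 / (α - 1) ^ 2 / S) < 0 :=
    mul_neg_of_pos_of_neg (by positivity) (by linarith)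
  convert hfinal using 1
  field_simp
  ring
end

section
/- (GMM mechanism.) Let ε > 0, α > 1 and θ² ≥ 0. Let K, L be positive integers, let (π_{k,l})_{1≤k≤K, 1≤l≤L} be nonnegative reals with Σ_{k,l} π_{k,l} = 1, and set w_{i,k} = Σ_{l} π_{k,l} and w_{j,l} = Σ_{k} π_{k,l}. Let μ_{i,k}, μ_{j,l} ∈ ℝ and σ_{i,k}², σ_{j,l}² > 0, and assume that σ_{i,k}² + θ² + α(σ_{j,l}² − σ_{i,k}²) > 0 for all k, l. Define the mixture densities P_i(y) = Σ_{k} w_{i,k} φ(y; μ_{i,k}, σ_{i,k}² + θ²) and P_j(y) = Σ_{l} w_{j,l} φ(y; μ_{j,l}, σ_{j,l}² + θ²), and for each pair (k, l) define ψ_{k,l}(θ) = ( (α−1) / ( 2(σ_{i,k}² + θ² + α(σ_{j,l}² − σ_{i,k}²)) ) ) · ( α(μ_{i,k} − μ_{j,l})² + α²(σ_{j,l}² − σ_{i,k}²)² / ( (α−1)(σ_{i,k}² + θ²) ) ). If Σ_{k,l} π_{k,l} · exp( ψ_{k,l}(θ) ) ≤ exp( (α−1)ε ), then ∫_ℝ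 P_i(y)^α P_j(y)^{1−α} dy ≤ exp( (α−1)ε ), i.e., the Rényi divergence of order α between P_i and P_j is at most ε. -/
open MeasureTheory

theorem gaussianPdf_eq_exp {μ v : ℝ} (hv : 0 < v) (y : ℝ) :
    gaussianPdf μ v y
      = Real.exp (-(1 / 2) * Real.log (2 * Real.pi * v) - (y - μ) ^ 2 / (2 * v)) := by
  have h : 0 < 2 * Real.pi * v := by positivity
  rw [gaussianPdf, Real.rpow_def_of_pos h, ← Real.exp_add]
  congr 1
  ring

theorem gaussianPdf_pos {μ v : ℝ} (hv : 0 < v) (y : ℝ) : 0 < gaussianPdf μ v y := by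
  rw [gaussianPdf_eq_exp hv]
  exact Real.exp_pos _

theorem measurable_gaussianPdf (μ v : ℝ) : Measurable (gaussianPdf μ v) := by
  unfold gaussianPdf
  fun_prop

/-- Joint convexity of `(a, b) ↦ a ^ α * b ^ (1 - α)`, for finite convex combinations. -/
theorem sum_rpow_mul_sum_rpow_le {ι : Type*} (s : Finset ι) {α : ℝ} (hα : 1 ≤ α)
    (w a b : ι → ℝ) (hw : ∀ i ∈ s, 0 ≤ w i) (ha : ∀ i ∈ s, 0 ≤ a i) (hb : ∀ i ∈ s, 0 < b i)
    (hB : 0 < ∑ i ∈ s, w i * b i) :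
    (∑ i ∈ s, w i * a i) ^ α * (∑ i ∈ s, w i * b i) ^ (1 - α)
      ≤ ∑ i ∈ s, w i * (a i ^ α * b i ^ (1 - α)) := by
  set B := ∑ i ∈ s, w i * b i with hBdef
  have hjensen := Real.rpow_arith_mean_le_arith_mean_rpow s (fun i => w i * b i / B)
    (fun i => a i / b i)
    (fun i hi => div_nonneg (mul_nonneg (hw i hi) (hb i hi).le) hB.le)
    (by rw [← Finset.sum_div, ← hBdef, div_self hB.ne'])
    (fun i hi => div_nonneg (ha i hi) (hb i hi).le) hα
  have hmean : ∑ i ∈ s, w i * b i / B * (a i / b i) = (∑ i ∈ s, w i * a i) / B := by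
    rw [Finset.sum_div]
    refine Finset.sum_congr rfl fun i hi => ?_
    have := (hb i hi).ne'
    field_simp
  have hA : 0 ≤ ∑ i ∈ s, w i * a i :=
    Finset.sum_nonneg fun i hi => mul_nonneg (hw i hi) (ha i hi)
  rw [hmean, Real.div_rpow hA hB.le] at hjensen
  calc (∑ i ∈ s, w i * a i) ^ α * B ^ (1 - α)
      = B * ((∑ i ∈ s, w i * a i) ^ α / B ^ α) := by
        rw [Real.rpow_sub hB, Real.rpow_one]
        ring
    _ ≤ B * ∑ i ∈ s, w i * b i / B * (a i / b i) ^ α := by gcongr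
    _ = ∑ i ∈ s, w i * (a i ^ α * b i ^ (1 - α)) := by
        rw [Finset.mul_sum]
        refine Finset.sum_congr rfl fun i hi => ?_
        rw [Real.div_rpow (ha i hi) (hb i hi).le, Real.rpow_sub (hb i hi), Real.rpow_one]
        field_simp

theorem gaussianPdf_rpow_mul_rpow {α μ₁ μ₂ s t : ℝ} (hs : 0 < s) (ht : 0 < t)
    (hv : 0 < s + α * (t - s)) (y : ℝ) :
    gaussianPdf μ₁ s y ^ α * gaussianPdf μ₂ t y ^ (1 - α)
      = Real.exp (-(α / 2) * Real.log (2 * Real.pi * s) - (1 - α) / 2 * Real.log (2 * Real.pi * t)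
          + α * (α - 1) * (μ₁ - μ₂) ^ 2 / (2 * (s + α * (t - s))))
        * Real.exp (-((s + α * (t - s)) / (2 * (s * t)))
          * (y - (α * t * μ₁ - (α - 1) * s * μ₂) / (s + α * (t - s))) ^ 2) := by
  rw [gaussianPdf_eq_exp hs, gaussianPdf_eq_exp ht, ← Real.exp_mul, ← Real.exp_mul,
    ← Real.exp_add, ← Real.exp_add]
  congr 1
  have := hv.ne'
  field_simp
  ring

theorem integrable_gaussianPdf_rpow_mul_rpow {α μ₁ μ₂ s t : ℝ} (hs : 0 < s) (ht : 0 < t)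
    (hv : 0 < s + α * (t - s)) :
    Integrable fun y => gaussianPdf μ₁ s y ^ α * gaussianPdf μ₂ t y ^ (1 - α) := by
  simp_rw [gaussianPdf_rpow_mul_rpow hs ht hv]
  exact ((integrable_exp_neg_mul_sq (by positivity)).comp_sub_right _).const_mul _

theorem integral_gaussianPdf_rpow_mul_rpow_s19 {α μ₁ μ₂ s t : ℝ} (hs : 0 < s) (ht : 0 < t)
    (hv : 0 < s + α * (t - s)) :
    ∫ y, gaussianPdf μ₁ s y ^ α * gaussianPdf μ₂ t y ^ (1 - α)
      = Real.exp (1 / 2 * ((1 - α) * Real.log s + α * Real.log t - Real.log (s + α * (t - s)))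
          + α * (α - 1) * (μ₁ - μ₂) ^ 2 / (2 * (s + α * (t - s)))) := by
  simp_rw [gaussianPdf_rpow_mul_rpow hs ht hv]
  rw [integral_const_mul, integral_sub_right_eq_self
    (fun y => Real.exp (-((s + α * (t - s)) / (2 * (s * t))) * y ^ 2)), integral_gaussian,
    Real.sqrt_eq_rpow, Real.rpow_def_of_pos (by positivity), ← Real.exp_add]
  congr 1
  have hpi := Real.pi_pos.ne'
  have hlog : ∀ {x : ℝ}, 0 < x →
      Real.log (2 * Real.pi * x) = Real.log 2 + Real.log Real.pi + Real.log x := fun hx => by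
    rw [Real.log_mul (by positivity) hx.ne', Real.log_mul two_ne_zero hpi]
  rw [hlog hs, hlog ht, Real.log_div hpi (by positivity), Real.log_div hv.ne' (by positivity),
    Real.log_mul two_ne_zero (by positivity), Real.log_mul hs.ne' ht.ne']
  ring

theorem log_variance_ratio_le {α s t : ℝ} (hα : 0 ≤ α) (hs : 0 < s) (ht : 0 < t)
    (hv : 0 < s + α * (t - s)) :
    (1 - α) * Real.log s + α * Real.log t - Real.log (s + α * (t - s))
      ≤ α ^ 2 * (t - s) ^ 2 / ((s + α * (t - s)) * s) := by
  have h₁ := Real.log_le_sub_one_of_pos (div_pos ht hs)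
  have h₂ := Real.log_le_sub_one_of_pos (div_pos hs hv)
  rw [Real.log_div ht.ne' hs.ne'] at h₁
  rw [Real.log_div hs.ne' hv.ne'] at h₂
  calc _ = α * (Real.log t - Real.log s) + (Real.log s - Real.log (s + α * (t - s))) := by ring
    _ ≤ α * (t / s - 1) + (s / (s + α * (t - s)) - 1) := by gcongr
    _ = _ := by
      have := hv.ne'
      field_simp
      ring

theorem integral_gaussianPdf_rpow_mul_rpow_le {α μ₁ μ₂ s t : ℝ} (hα : 1 < α)
    (hs : 0 < s) (ht : 0 < t) (hv : 0 < s + α * (t - s)) :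
    ∫ y, gaussianPdf μ₁ s y ^ α * gaussianPdf μ₂ t y ^ (1 - α)
      ≤ Real.exp ((α - 1) / (2 * (s + α * (t - s)))
          * (α * (μ₁ - μ₂) ^ 2 + α ^ 2 * (t - s) ^ 2 / ((α - 1) * s))) := by
  rw [integral_gaussianPdf_rpow_mul_rpow_s19 hs ht hv, Real.exp_le_exp]
  have h := log_variance_ratio_le (by linarith) hs ht hv
  have hα' : α - 1 ≠ 0 := by linarith
  have := hv.ne'
  calc _ ≤ 1 / 2 * (α ^ 2 * (t - s) ^ 2 / ((s + α * (t - s)) * s))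
        + α * (α - 1) * (μ₁ - μ₂) ^ 2 / (2 * (s + α * (t - s))) := by gcongr
    _ = _ := by
      field_simp
      ring

/-- A bound on the integral defining the Rényi divergence bounds the divergence itself. -/
theorem renyiDiv_le_of_lintegral_le {ε α : ℝ} {p q : ℝ → ℝ} (hε : 0 ≤ ε) (hα : 1 < α)
    (hp : Measurable p) (hq : Measurable q) (hp0 : ∀ y, 0 ≤ p y) (hq0 : ∀ y, 0 ≤ q y)
    (h : ∫⁻ y, ENNReal.ofReal (p y ^ α * q y ^ (1 - α))
      ≤ ENNReal.ofReal (Real.exp ((α - 1) * ε))) :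
    renyiDiv α p q ≤ ε := by
  have hα' : 0 < α - 1 := by linarith
  have hf0 : ∀ y, 0 ≤ p y ^ α * q y ^ (1 - α) := fun y =>
    mul_nonneg (Real.rpow_nonneg (hp0 y) _) (Real.rpow_nonneg (hq0 y) _)
  have hle : ∫ y, p y ^ α * q y ^ (1 - α) ≤ Real.exp ((α - 1) * ε) := by
    rw [integral_eq_lintegral_of_nonneg_ae (Filter.Eventually.of_forall hf0)
      ((hp.pow_const _).mul (hq.pow_const _)).aestronglyMeasurable]
    exact ENNReal.toReal_le_of_le_ofReal (Real.exp_pos _).le h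
  have hlog : Real.log (∫ y, p y ^ α * q y ^ (1 - α)) ≤ (α - 1) * ε := by
    rcases (integral_nonneg hf0 : 0 ≤ ∫ y, p y ^ α * q y ^ (1 - α)).eq_or_lt with h0 | h0
    · rw [← h0, Real.log_zero]
      positivity
    · exact (Real.log_le_iff_le_exp h0).2 hle
  rw [renyiDiv, one_div, inv_mul_le_iff₀ hα']
  exact hlog

theorem stmt_19 (ε α θ2 : ℝ) (hε : 0 < ε) (hα : 1 < α) (hθ : 0 ≤ θ2)
    (K L : ℕ) (hK : 0 < K) (hL : 0 < L)
    (pl : Fin K → Fin L → ℝ) (hpl : ∀ k l, 0 ≤ pl k l)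
    (hplsum : ∑ k, ∑ l, pl k l = 1)
    (μi : Fin K → ℝ) (μj : Fin L → ℝ) (σi2 : Fin K → ℝ) (σj2 : Fin L → ℝ)
    (hσi : ∀ k, 0 < σi2 k) (hσj : ∀ l, 0 < σj2 l)
    (hpos : ∀ k l, 0 < σi2 k + θ2 + α * (σj2 l - σi2 k))
    (hcond : ∑ k, ∑ l, pl k l
        * Real.exp (((α - 1) / (2 * (σi2 k + θ2 + α * (σj2 l - σi2 k))))
            * (α * (μi k - μj l) ^ 2
              + α ^ 2 * (σj2 l - σi2 k) ^ 2 / ((α - 1) * (σi2 k + θ2))))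
      ≤ Real.exp ((α - 1) * ε)) :
    (∫⁻ y : ℝ, ENNReal.ofReal
        ((∑ k, (∑ l, pl k l) * gaussianPdf (μi k) (σi2 k + θ2) y) ^ α
          * (∑ l, (∑ k, pl k l) * gaussianPdf (μj l) (σj2 l + θ2) y) ^ (1 - α))
      ≤ ENNReal.ofReal (Real.exp ((α - 1) * ε)))
    ∧ renyiDiv α (fun y => ∑ k, (∑ l, pl k l) * gaussianPdf (μi k) (σi2 k + θ2) y)
        (fun y => ∑ l, (∑ k, pl k l) * gaussianPdf (μj l) (σj2 l + θ2) y) ≤ ε := by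
  have hs : ∀ k, 0 < σi2 k + θ2 := fun k => add_pos_of_pos_of_nonneg (hσi k) hθ
  have ht : ∀ l, 0 < σj2 l + θ2 := fun l => add_pos_of_pos_of_nonneg (hσj l) hθ
  have hdiff : ∀ k l, σj2 l + θ2 - (σi2 k + θ2) = σj2 l - σi2 k := fun k l => by ring
  have hv : ∀ k l, 0 < σi2 k + θ2 + α * (σj2 l + θ2 - (σi2 k + θ2)) := fun k l => by
    rw [hdiff]
    exact hpos k l
  let a : Fin K → ℝ → ℝ := fun k => gaussianPdf (μi k) (σi2 k + θ2)
  let b : Fin L → ℝ → ℝ := fun l => gaussianPdf (μj l) (σj2 l + θ2)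
  have ha : ∀ k y, 0 < a k y := fun k y => gaussianPdf_pos (hs k) y
  have hb : ∀ l y, 0 < b l y := fun l y => gaussianPdf_pos (ht l) y
  have hPi : ∀ y, ∑ k, (∑ l, pl k l) * a k y
      = ∑ x : Fin K × Fin L, pl x.1 x.2 * a x.1 y := fun y => by
    simp_rw [Fintype.sum_prod_type, Finset.sum_mul]
  have hPj : ∀ y, ∑ l, (∑ k, pl k l) * b l y
      = ∑ x : Fin K × Fin L, pl x.1 x.2 * b x.2 y := fun y => by
    simp_rw [Fintype.sum_prod_type_right, Finset.sum_mul]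
  have hPj_pos : ∀ y, 0 < ∑ x : Fin K × Fin L, pl x.1 x.2 * b x.2 y := fun y => by
    obtain ⟨x, -, hx⟩ : ∃ x ∈ (Finset.univ : Finset (Fin K × Fin L)), pl x.1 x.2 ≠ 0 := by
      apply Finset.exists_ne_zero_of_sum_ne_zero
      rw [Fintype.sum_prod_type, hplsum]
      exact one_ne_zero
    exact Finset.sum_pos' (fun x _ => mul_nonneg (hpl _ _) (hb _ _).le)
      ⟨x, Finset.mem_univ x, mul_pos ((hpl _ _).lt_of_ne' hx) (hb _ _)⟩
  let g : ℝ → ℝ := fun y =>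
    ∑ x : Fin K × Fin L, pl x.1 x.2 * (a x.1 y ^ α * b x.2 y ^ (1 - α))
  have h_integrable : ∀ x : Fin K × Fin L,
      Integrable fun y => pl x.1 x.2 * (a x.1 y ^ α * b x.2 y ^ (1 - α)) := fun x =>
    (integrable_gaussianPdf_rpow_mul_rpow (hs x.1) (ht x.2) (hv x.1 x.2)).const_mul _
  have hg0 : ∀ y, 0 ≤ g y := fun y => Finset.sum_nonneg fun x _ =>
    mul_nonneg (hpl _ _) (mul_nonneg (Real.rpow_nonneg (ha _ _).le _)
      (Real.rpow_nonneg (hb _ _).le _))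
  have hg_le : ∫ y, g y ≤ Real.exp ((α - 1) * ε) := by
    rw [integral_finsetSum _ fun x _ => h_integrable x]
    refine le_trans ?_ hcond
    rw [← Fintype.sum_prod_type']
    refine Finset.sum_le_sum fun x _ => ?_
    rw [integral_const_mul]
    refine mul_le_mul_of_nonneg_left ?_ (hpl _ _)
    have h := integral_gaussianPdf_rpow_mul_rpow_le (μ₁ := μi x.1) (μ₂ := μj x.2) hα
      (hs x.1) (ht x.2) (hv x.1 x.2)
    rwa [hdiff] at h
  have hlint : ∫⁻ y, ENNReal.ofReal ((∑ k, (∑ l, pl k l) * a k y) ^ α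
        * (∑ l, (∑ k, pl k l) * b l y) ^ (1 - α))
      ≤ ENNReal.ofReal (Real.exp ((α - 1) * ε)) := by
    calc _ ≤ ∫⁻ y, ENNReal.ofReal (g y) := by
          refine lintegral_mono fun y => ENNReal.ofReal_le_ofReal ?_
          rw [hPi, hPj]
          exact sum_rpow_mul_sum_rpow_le _ hα.le _ _ _ (fun x _ => hpl _ _)
            (fun x _ => (ha _ _).le) (fun x _ => hb _ _) (hPj_pos y)
      _ = ENNReal.ofReal (∫ y, g y) :=
          (ofReal_integral_eq_lintegral_ofReal (integrable_finsetSum _ fun x _ => h_integrable x)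
            (Filter.Eventually.of_forall hg0)).symm
      _ ≤ _ := ENNReal.ofReal_le_ofReal hg_le
  refine ⟨hlint, renyiDiv_le_of_lintegral_le hε.le hα ?_ ?_ ?_ ?_ hlint⟩
  · exact Finset.measurable_fun_sum _ fun k _ => (measurable_gaussianPdf _ _).const_mul _
  · exact Finset.measurable_fun_sum _ fun l _ => (measurable_gaussianPdf _ _).const_mul _
  · exact fun y => Finset.sum_nonneg fun k _ =>
      mul_nonneg (Finset.sum_nonneg fun l _ => hpl k l) (ha k y).le
  · exact fun y => Finset.sum_nonneg fun l _ =>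
      mul_nonneg (Finset.sum_nonneg fun k _ => hpl k l) (hb l y).le
end
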